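/- Let τ > 0 be real. Define S₁, S₂, S₃ : (0,1) → ℂ by S₁(t) = i·t·∑_{n=0}^∞ [ (1/2)ₙ (1/2)ₙ (3/2)ₙ / ( (3/2 − i/(2τ))ₙ (3/2 + i/(2τ))ₙ · n! ) ]·t^{2n}, S₂(t) = t^{−i/(2τ)}·∑_{n=0}^∞ [ (1 − i/(2τ))ₙ (−i/(2τ))ₙ (−i/(2τ))ₙ / ( (1/2 − i/(2τ))ₙ (1 − i/τ)ₙ · n! ) ]·t^{2n}, and S₃(t) = t^{i/(2τ)}·∑_{n=0}^∞ [ (1 + i/(2τ))ₙ (i/(2τ))ₙ (i/(2τ))ₙ / ( (1/2 + i/(2τ))ₙ (1 + i/τ)ₙ · n! ) ]·t^{2n}, where t^{z} = exp(z·log t). Then S₁, S₂, S₃ are linearly independent over ℂ as functions on (0,1): if c₁S₁ + c₂S₂ + c₃S₃ = 0 identically on (0,1) for c₁, c₂, c₃ ∈ ℂ, then c₁ = c₂ = c₃ = 0. -/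

import Mathlib

/-- The Pochhammer symbol (ascending factorial) `(x)ₙ` for complex `x`. -/
noncomputable def poch (x : ℂ) (n : ℕ) : ℂ := (ascPochhammer ℂ n).eval x

/-- The coefficients of the hypergeometric series defining `S₁`. -/
noncomputable def S1coef (τ : ℝ) (n : ℕ) : ℂ :=
  poch (1 / 2) n * poch (1 / 2) n * poch (3 / 2) n /
    (poch (3 / 2 - Complex.I / (2 * τ)) n * poch (3 / 2 + Complex.I / (2 * τ)) n *
      n.factorial)

/-- `S₁(t) = i t ⬝ ₃F₂(1/2, 1/2, 3/2; 3/2 − i/(2τ), 3/2 + i/(2τ); t²)`. -/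
noncomputable def S1 (τ : ℝ) (t : ℝ) : ℂ :=
  Complex.I * t * ∑' n : ℕ, S1coef τ n * (t : ℂ) ^ (2 * n)

/-- The coefficients of the hypergeometric series defining `S₂`. -/
noncomputable def S2coef (τ : ℝ) (n : ℕ) : ℂ :=
  poch (1 - Complex.I / (2 * τ)) n * poch (-(Complex.I / (2 * τ))) n *
      poch (-(Complex.I / (2 * τ))) n /
    (poch (1 / 2 - Complex.I / (2 * τ)) n * poch (1 - Complex.I / τ) n * n.factorial)

/-- `S₂(t) = t^{−i/(2τ)} ⬝ ₃F₂(1 − i/(2τ), −i/(2τ), −i/(2τ); 1/2 − i/(2τ), 1 − i/τ; t²)`,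
where `t^{−i/(2τ)} = exp(−(i/(2τ)) log t)`. -/
noncomputable def S2 (τ : ℝ) (t : ℝ) : ℂ :=
  Complex.exp (-(Complex.I / (2 * τ)) * Real.log t) *
    ∑' n : ℕ, S2coef τ n * (t : ℂ) ^ (2 * n)

/-- The coefficients of the hypergeometric series defining `S₃`. -/
noncomputable def S3coef (τ : ℝ) (n : ℕ) : ℂ :=
  poch (1 + Complex.I / (2 * τ)) n * poch (Complex.I / (2 * τ)) n *
      poch (Complex.I / (2 * τ)) n /
    (poch (1 / 2 + Complex.I / (2 * τ)) n * poch (1 + Complex.I / τ) n * n.factorial)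

/-- `S₃(t) = t^{i/(2τ)} ⬝ ₃F₂(1 + i/(2τ), i/(2τ), i/(2τ); 1/2 + i/(2τ), 1 + i/τ; t²)`,
where `t^{i/(2τ)} = exp((i/(2τ)) log t)`. -/
noncomputable def S3 (τ : ℝ) (t : ℝ) : ℂ :=
  Complex.exp (Complex.I / (2 * τ) * Real.log t) *
    ∑' n : ℕ, S3coef τ n * (t : ℂ) ^ (2 * n)

open Filter Topology

theorem poch_zero (x : ℂ) : poch x 0 = 1 := by simp [poch]

theorem poch_succ (x : ℂ) (n : ℕ) : poch x (n + 1) = poch x n * (x + n) :=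
  ascPochhammer_succ_eval n x

theorem poch_one (n : ℕ) : poch 1 n = n.factorial := by
  simp [poch, ascPochhammer_eval_one]

theorem norm_poch_le (a d : ℂ) (hd : 1 / 2 ≤ d.re) (n : ℕ) :
    ‖poch a n‖ ≤ (2 * ‖a‖ + 1) ^ n * ‖poch d n‖ := by
  induction n with
  | zero => simp [poch_zero]
  | succ n ih =>
    have hlow : 1 / 2 + (n : ℝ) ≤ ‖d + n‖ := by
      refine le_trans ?_ (Complex.re_le_norm _)
      simpa using hd
    have hup : ‖a + n‖ ≤ ‖a‖ + n := by
      simpa using norm_add_le a (n : ℂ)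
    have ha := norm_nonneg a
    have hn : (0 : ℝ) ≤ n := n.cast_nonneg
    have hstep : ‖a + n‖ ≤ (2 * ‖a‖ + 1) * ‖d + n‖ := by
      nlinarith [mul_le_mul_of_nonneg_left hlow (by positivity : 0 ≤ 2 * ‖a‖ + 1),
        mul_nonneg ha hn]
    rw [poch_succ, poch_succ, norm_mul, norm_mul]
    calc ‖poch a n‖ * ‖a + n‖
        ≤ ((2 * ‖a‖ + 1) ^ n * ‖poch d n‖) * ((2 * ‖a‖ + 1) * ‖d + n‖) := by gcongr
      _ = _ := by ring

theorem norm_poch_div_le (a d : ℂ) (hd : 1 / 2 ≤ d.re) (n : ℕ) :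
    ‖poch a n / poch d n‖ ≤ (2 * ‖a‖ + 1) ^ n := by
  rw [norm_div]
  exact div_le_of_le_mul₀ (norm_nonneg _) (by positivity) (norm_poch_le a d hd n)

/-- Coefficients of a `₃F₂` whose lower parameters have real part at least `1/2` grow at most
geometrically. -/
theorem norm_hypergeometric_coef_le (a b c d e : ℂ) (hd : 1 / 2 ≤ d.re) (he : 1 / 2 ≤ e.re)
    (n : ℕ) :
    ‖poch a n * poch b n * poch c n / (poch d n * poch e n * n.factorial)‖ ≤
      ((2 * ‖a‖ + 1) * (2 * ‖b‖ + 1) * (2 * ‖c‖ + 1)) ^ n := by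
  rw [← poch_one, mul_div_mul_comm, mul_div_mul_comm, norm_mul, norm_mul, mul_pow, mul_pow]
  gcongr
  · exact norm_poch_div_le a d hd n
  · exact norm_poch_div_le b e he n
  · exact norm_poch_div_le c 1 (by norm_num) n

theorem tendsto_tsum_mul_pow_two_mul {u : ℕ → ℂ} {K : ℝ} (hu : ∀ n, ‖u n‖ ≤ K ^ n) :
    Tendsto (fun t : ℝ => ∑' n : ℕ, u n * (t : ℂ) ^ (2 * n)) (𝓝 0) (𝓝 (u 0)) := by
  have hlim : u 0 = ∑' n : ℕ, u n * ((0 : ℝ) : ℂ) ^ (2 * n) := by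
    rw [tsum_eq_single 0 (fun n hn => by simp [hn])]
    simp
  rw [hlim]
  refine tendsto_tsum_of_dominated_convergence (bound := fun n => (1 / 2 : ℝ) ^ n)
    (summable_geometric_of_lt_one (by norm_num) (by norm_num)) (fun n => ?_) ?_
  · have hcont : Continuous fun t : ℝ => u n * (t : ℂ) ^ (2 * n) := by fun_prop
    exact hcont.tendsto 0
  · have hsmall : Tendsto (fun t : ℝ => K * t ^ 2) (𝓝 0) (𝓝 0) := by
      have hcont : Continuous fun t : ℝ => K * t ^ 2 := by fun_prop
      simpa using hcont.tendsto 0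
    have hK : 0 ≤ K := by simpa using (norm_nonneg _).trans (hu 1)
    filter_upwards [hsmall.eventually_le_const (by norm_num : (0 : ℝ) < 1 / 2)] with t ht n
    rw [norm_mul, norm_pow, Complex.norm_real, Real.norm_eq_abs, pow_mul, sq_abs]
    calc ‖u n‖ * (t ^ 2) ^ n ≤ K ^ n * (t ^ 2) ^ n := by gcongr; exact hu n
      _ = (K * t ^ 2) ^ n := (mul_pow _ _ _).symm
      _ ≤ (1 / 2) ^ n := by gcongr

theorem tendsto_S1_series (τ : ℝ) :
    Tendsto (fun t : ℝ => ∑' n : ℕ, S1coef τ n * (t : ℂ) ^ (2 * n)) (𝓝 0) (𝓝 1) := by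
  have h := tendsto_tsum_mul_pow_two_mul (u := S1coef τ) fun n =>
    norm_hypergeometric_coef_le _ _ _ _ _ (by simp [Complex.div_re]; norm_num)
      (by simp [Complex.div_re]; norm_num) n
  simpa [S1coef, poch_zero] using h

theorem tendsto_S2_series (τ : ℝ) :
    Tendsto (fun t : ℝ => ∑' n : ℕ, S2coef τ n * (t : ℂ) ^ (2 * n)) (𝓝 0) (𝓝 1) := by
  have h := tendsto_tsum_mul_pow_two_mul (u := S2coef τ) fun n =>
    norm_hypergeometric_coef_le _ _ _ _ _ (by simp [Complex.div_re])
      (by simp [Complex.div_re]; norm_num) n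
  simpa [S2coef, poch_zero] using h

theorem tendsto_S3_series (τ : ℝ) :
    Tendsto (fun t : ℝ => ∑' n : ℕ, S3coef τ n * (t : ℂ) ^ (2 * n)) (𝓝 0) (𝓝 1) := by
  have h := tendsto_tsum_mul_pow_two_mul (u := S3coef τ) fun n =>
    norm_hypergeometric_coef_le _ _ _ _ _ (by simp [Complex.div_re])
      (by simp [Complex.div_re]; norm_num) n
  simpa [S3coef, poch_zero] using h

theorem tendsto_S1_zero (τ : ℝ) : Tendsto (S1 τ) (𝓝 0) (𝓝 0) := by
  have hcont : Continuous fun t : ℝ => Complex.I * (t : ℂ) := by fun_prop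
  have h := (hcont.tendsto 0).mul (tendsto_S1_series τ)
  rw [Complex.ofReal_zero, mul_zero, zero_mul] at h
  exact h

/-- Along `t = exp (-(4πτk + 2πτr))`, `k → ∞`, the oscillating factors of `S₂` and `S₃` are
constant. -/
theorem phase_relation (τ : ℝ) (hτ : 0 < τ) (c₁ c₂ c₃ : ℂ)
    (h : ∀ t ∈ Set.Ioo (0 : ℝ) 1, c₁ * S1 τ t + c₂ * S2 τ t + c₃ * S3 τ t = 0) (r : ℝ) :
    c₂ * Complex.exp (Real.pi * r * Complex.I) +
      c₃ * Complex.exp (-(Real.pi * r * Complex.I)) = 0 := by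
  have hτ' : (τ : ℂ) ≠ 0 := by exact_mod_cast hτ.ne'
  set s : ℕ → ℝ := fun k => 4 * Real.pi * τ * k + 2 * Real.pi * τ * r with hs
  have hs_top : Tendsto s atTop atTop :=
    tendsto_atTop_add_const_right _ _
      (tendsto_natCast_atTop_atTop.const_mul_atTop (by positivity))
  have ht : Tendsto (fun k => Real.exp (-s k)) atTop (𝓝 0) :=
    Real.tendsto_exp_neg_atTop_nhds_zero.comp hs_top
  have hphase (k : ℕ) : Complex.I / (2 * τ) * (s k : ℂ) =
      Real.pi * r * Complex.I + k * (2 * Real.pi * Complex.I) := by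
    simp only [hs]
    push_cast
    field_simp
    ring
  have hS2 (k : ℕ) : S2 τ (Real.exp (-s k)) = Complex.exp (Real.pi * r * Complex.I) *
      ∑' n : ℕ, S2coef τ n * (Real.exp (-s k) : ℂ) ^ (2 * n) := by
    rw [S2, Real.log_exp, Complex.ofReal_neg, neg_mul_neg, hphase,
      Complex.exp_add, Complex.exp_nat_mul_two_pi_mul_I, mul_one]
  have hS3 (k : ℕ) : S3 τ (Real.exp (-s k)) = Complex.exp (-(Real.pi * r * Complex.I)) *
      ∑' n : ℕ, S3coef τ n * (Real.exp (-s k) : ℂ) ^ (2 * n) := by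
    rw [S3, Real.log_exp, Complex.ofReal_neg, mul_neg, hphase, neg_add,
      Complex.exp_add, Complex.exp_neg (_ * (2 * _ * _)), Complex.exp_nat_mul_two_pi_mul_I,
      inv_one, mul_one]
  have hlim : Tendsto (fun k => c₁ * S1 τ (Real.exp (-s k)) + c₂ * S2 τ (Real.exp (-s k)) +
      c₃ * S3 τ (Real.exp (-s k))) atTop
      (𝓝 (c₁ * 0 + c₂ * (Complex.exp (Real.pi * r * Complex.I) * 1) +
        c₃ * (Complex.exp (-(Real.pi * r * Complex.I)) * 1))) := by
    simp only [hS2, hS3]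
    exact ((((tendsto_S1_zero τ).comp ht).const_mul c₁).add
      ((((tendsto_S2_series τ).comp ht).const_mul _).const_mul c₂)).add
      ((((tendsto_S3_series τ).comp ht).const_mul _).const_mul c₃)
  have hzero : Tendsto (fun k => c₁ * S1 τ (Real.exp (-s k)) + c₂ * S2 τ (Real.exp (-s k)) +
      c₃ * S3 τ (Real.exp (-s k))) atTop (𝓝 0) := by
    refine tendsto_const_nhds.congr' ?_
    filter_upwards [hs_top.eventually_gt_atTop 0] with k hk
    exact (h _ ⟨Real.exp_pos _, by simpa using hk⟩).symm
  simpa using tendsto_nhds_unique hlim hzero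

theorem S1_S2_S3_linearly_independent (τ : ℝ) (hτ : 0 < τ) (c₁ c₂ c₃ : ℂ)
    (h : ∀ t ∈ Set.Ioo (0 : ℝ) 1, c₁ * S1 τ t + c₂ * S2 τ t + c₃ * S3 τ t = 0) :
    c₁ = 0 ∧ c₂ = 0 ∧ c₃ = 0 := by
  have hadd : c₂ + c₃ = 0 := by simpa using phase_relation τ hτ c₁ c₂ c₃ h 0
  have hsub : c₂ * Complex.I - c₃ * Complex.I = 0 := by
    have hhalf := phase_relation τ hτ c₁ c₂ c₃ h (1 / 2)
    have hangle : (Real.pi : ℂ) * ((1 / 2 : ℝ) : ℂ) * Complex.I =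
        Real.pi / 2 * Complex.I := by
      push_cast
      ring
    rw [hangle, Complex.exp_neg, Complex.exp_pi_div_two_mul_I, Complex.inv_I] at hhalf
    linear_combination hhalf
  have hdiff : c₂ - c₃ = 0 := by
    rw [← sub_mul] at hsub
    exact (mul_eq_zero.mp hsub).resolve_right Complex.I_ne_zero
  have hc₂ : c₂ = 0 := by linear_combination (hadd + hdiff) / 2
  have hc₃ : c₃ = 0 := by linear_combination (hadd - hdiff) / 2
  refine ⟨?_, hc₂, hc₃⟩
  have hzero : Tendsto (fun t : ℝ => c₁ * ∑' n : ℕ, S1coef τ n * (t : ℂ) ^ (2 * n))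
      (𝓝[>] 0) (𝓝 0) := by
    refine tendsto_const_nhds.congr' ?_
    filter_upwards [Ioo_mem_nhdsGT (zero_lt_one' ℝ)] with t ht
    have ht₀ : (t : ℂ) ≠ 0 := by exact_mod_cast ht.1.ne'
    have hS := h t ht
    rw [hc₂, hc₃, zero_mul, zero_mul, add_zero, add_zero, S1, mul_left_comm] at hS
    exact ((mul_eq_zero.mp hS).resolve_left (mul_ne_zero Complex.I_ne_zero ht₀)).symm
  simpa using tendsto_nhds_unique
    (((tendsto_S1_series τ).const_mul c₁).mono_left nhdsWithin_le_nhds) hzero
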